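/- arXiv:2412.04271 — 6 statements merged into one kernel-verified Lean document; each statement's English description precedes it below -/
import Mathlib

section
/- Assume gcd(N, M) = 1. Then for every Fock vector n ∈ S: (i) μ(σ^a n) = μ(n) + a·N in ZMod M for every natural number a; (ii) for all natural numbers a, b < M, σ^a n = σ^b n implies a = b (so the σ-orbit of n has exactly M elements); and (iii) there exists a unique natural number a < M with μ(σ^a n) = 0. -/
open Matrix Complex BigOperators Finset

noncomputable section

set_option linter.unusedVariables false

/-- `ω = exp(2πi/M)`. -/
def hwOmega (M : ℕ) : ℂ := Complex.exp (2 * Real.pi * Complex.I / M)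

/-- Single-photon Heisenberg–Weyl matrix `L_{k,l} = X^k Z^l`,
with entries `L_{k,l}[m,m'] = ω^{l·m'}` if `m = m' + k` and `0` otherwise. -/
def HW (M : ℕ) [NeZero M] (k l : ZMod M) : Matrix (ZMod M) (ZMod M) ℂ :=
  Matrix.of fun m m' => if m = m' + k then hwOmega M ^ (l * m').val else 0

/-- Fock vectors: mode-occupation functions `ZMod M → ℕ` with total photon number `N`. -/
abbrev Fock (M N : ℕ) [NeZero M] := {n : ZMod M → ℕ // ∑ m, n m = N}

instance (M N : ℕ) [NeZero M] : Fintype (Fock M N) :=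
  Fintype.ofInjective
    (fun n (m : ZMod M) => (⟨n.1 m, Nat.lt_succ_of_le (le_of_le_of_eq
      (Finset.single_le_sum (fun i _ => Nat.zero_le _) (Finset.mem_univ m)) n.2)⟩ : Fin (N+1)))
    (fun a b h => Subtype.ext (funext fun m => congrArg Fin.val (congrFun h m)))

/-- The mode shift `σ`, `(σ n)(m) = n(m - 1)`. -/
def modeShift (M N : ℕ) [NeZero M] (n : Fock M N) : Fock M N :=
  ⟨fun m => n.1 (m - 1), by
    exact (Fintype.sum_equiv (Equiv.subRight (1 : ZMod M)) _ _ (fun m => rfl)).trans n.2⟩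

/-- The total mode index `μ(n) = ∑ m, m·n(m) ∈ ZMod M`. -/
def tmi (M N : ℕ) [NeZero M] (n : Fock M N) : ZMod M := ∑ m : ZMod M, m * (n.1 m : ZMod M)

theorem tmi_modeShift (M N : ℕ) [NeZero M] (n : Fock M N) :
    tmi M N (modeShift M N n) = tmi M N n + (N : ZMod M) := by
  have hN : (N : ZMod M) = ∑ m : ZMod M, (n.1 m : ZMod M) := by
    exact_mod_cast congrArg (Nat.cast : ℕ → ZMod M) n.2.symm
  rw [hN]
  simp only [tmi, modeShift]
  rw [← Finset.sum_add_distrib]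
  refine Fintype.sum_equiv (Equiv.subRight (1 : ZMod M)) _ _ fun m => ?_
  simp only [Equiv.subRight_apply]
  ring

theorem tmi_iterate_modeShift (M N : ℕ) [NeZero M] (n : Fock M N) (a : ℕ) :
    tmi M N ((modeShift M N)^[a] n) = tmi M N n + (a : ZMod M) * (N : ZMod M) := by
  induction a with
  | zero => simp
  | succ a ih =>
    rw [Function.iterate_succ_apply', tmi_modeShift, ih]
    push_cast
    ring

theorem ZMod.natCast_injOn_lt (M : ℕ) {a b : ℕ} (ha : a < M) (hb : b < M)
    (h : (a : ZMod M) = b) : a = b :=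
  Nat.ModEq.eq_of_lt_of_lt ((ZMod.natCast_eq_natCast_iff a b M).1 h) ha hb

/-- for `gcd(N,M) = 1`, (i) `μ(σ^a n) = μ(n) + a·N`, (ii) the `σ`-orbit of any
Fock vector has exactly `M` distinct elements, (iii) each orbit has a unique representative
with total mode index `0`. -/
theorem modeShift_orbit (M N : ℕ) [NeZero M] (hN : 1 ≤ N) (hgcd : Nat.gcd N M = 1)
    (n : Fock M N) :
    (∀ a : ℕ, tmi M N ((modeShift M N)^[a] n) = tmi M N n + (a : ZMod M) * (N : ZMod M)) ∧
    (∀ a b : ℕ, a < M → b < M → (modeShift M N)^[a] n = (modeShift M N)^[b] n → a = b) ∧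
    (∃! a : ℕ, a < M ∧ tmi M N ((modeShift M N)^[a] n) = 0) := by
  have hu : IsUnit (N : ZMod M) := (ZMod.isUnit_iff_coprime N M).2 hgcd
  refine ⟨tmi_iterate_modeShift M N n, fun a b ha hb h => ?_, ?_⟩
  · have h' := congrArg (tmi M N) h
    rw [tmi_iterate_modeShift, tmi_iterate_modeShift] at h'
    exact ZMod.natCast_injOn_lt M ha hb (hu.mul_right_cancel (add_left_cancel h'))
  · obtain ⟨c, hc⟩ := hu.dvd (a := -tmi M N n)
    refine ⟨c.val, ⟨ZMod.val_lt c, ?_⟩, fun b hb => ?_⟩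
    · rw [tmi_iterate_modeShift, ZMod.natCast_zmod_val, mul_comm, ← hc, add_neg_cancel]
    · obtain ⟨hbM, h⟩ := hb
      rw [tmi_iterate_modeShift] at h
      refine ZMod.natCast_injOn_lt M hbM (ZMod.val_lt c) (hu.mul_right_cancel ?_)
      rw [ZMod.natCast_zmod_val, mul_comm c, ← hc, eq_neg_of_add_eq_zero_right h]

end
end

section
/- For every ρ : Matrix S S ℂ and all k, l ∈ ZMod M, the expectation value of a Heisenberg–Weyl operator is invariant under dephasing with respect to σ-orbits: trace(ρ * Λ_{k,l}) = trace(D(ρ) * Λ_{k,l}), where D(ρ) is the matrix with D(ρ)[v,n] = ρ[v,n] if v and n lie in the same σ-orbit (i.e. v = σ^a n for some natural number a) and D(ρ)[v,n] = 0 otherwise. -/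
open Matrix Complex BigOperators Finset

noncomputable section

set_option linter.unusedVariables false

/-- Multiphoton Heisenberg–Weyl matrix `Λ_{k,l}`, with entries `ω^{l·μ(n)}` at `(σ^k n, n)`
and `0` elsewhere. -/
def HWm (M N : ℕ) [NeZero M] (k l : ZMod M) : Matrix (Fock M N) (Fock M N) ℂ :=
  Matrix.of fun v n =>
    if v = (modeShift M N)^[k.val] n then hwOmega M ^ (l * tmi M N n).val else 0

lemma modeShift_iterate_apply (M N : ℕ) [NeZero M] (a : ℕ) (n : Fock M N) (m : ZMod M) :
    ((modeShift M N)^[a] n).1 m = n.1 (m - a) := by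
  induction a generalizing m with
  | zero => simp
  | succ a ih =>
    rw [Function.iterate_succ_apply']
    change ((modeShift M N)^[a] n).1 (m - 1) = _
    rw [ih, sub_sub, Nat.cast_succ, add_comm (1 : ZMod M)]

lemma modeShift_iterate_self (M N : ℕ) [NeZero M] (n : Fock M N) :
    (modeShift M N)^[M] n = n :=
  Subtype.ext <| funext fun m => by simp [modeShift_iterate_apply]

/-- Every iterate of the mode shift below the period `M` is undone by a further iterate. -/
lemma modeShift_iterate_sub_iterate (M N : ℕ) [NeZero M] {a : ℕ} (ha : a ≤ M) (n : Fock M N) :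
    (modeShift M N)^[M - a] ((modeShift M N)^[a] n) = n := by
  rw [← Function.iterate_add_apply, Nat.sub_add_cancel ha, modeShift_iterate_self]

open Classical in
/-- HW expectation values are invariant under dephasing with respect to
`σ`-orbits. -/
theorem HWm_trace_dephasing_invariant (M N : ℕ) [NeZero M] (hN : 1 ≤ N)
    (ρ : Matrix (Fock M N) (Fock M N) ℂ) (k l : ZMod M) :
    Matrix.trace (ρ * HWm M N k l) =
      Matrix.trace ((Matrix.of fun v n =>
        if ∃ a : ℕ, v = (modeShift M N)^[a] n then ρ v n else 0 :
          Matrix (Fock M N) (Fock M N) ℂ) * HWm M N k l) := by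
  simp only [Matrix.trace, Matrix.diag, Matrix.mul_apply, Matrix.of_apply]
  refine Finset.sum_congr rfl fun n _ => Finset.sum_congr rfl fun v _ => ?_
  by_cases hv : v = (modeShift M N)^[k.val] n
  · have horbit : ∃ a : ℕ, n = (modeShift M N)^[a] v :=
      ⟨M - k.val, by rw [hv, modeShift_iterate_sub_iterate M N (ZMod.val_lt k).le]⟩
    rw [if_pos horbit]
  · simp [HWm, hv]

end
end

section
/- Let W, V : Matrix (ZMod M) (ZMod M) ℂ with W unitary (Wᴴ * W = 1), and set U = Wᴴ * V * W. Then the DQC1 observable conjugation satisfies the block identity T(W,V)ᴴ * ζ₀ * T(W,V) = (1/2) • fromBlocks (U + Uᴴ) (Wᴴ * (Vᴴ − V)) ((V − Vᴴ) * W) (−(V + Vᴴ)); in particular its upper-left block is (U + Uᴴ)/2. -/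
open Matrix Complex BigOperators Finset

noncomputable section

set_option linter.unusedVariables false

/-- The balanced multimode beam splitter on the doubled modes. -/
def Hb (M : ℕ) [NeZero M] : Matrix (ZMod M ⊕ ZMod M) (ZMod M ⊕ ZMod M) ℂ :=
  ((1 : ℂ) / Real.sqrt 2) • Matrix.fromBlocks 1 1 1 (-1)

/-- The parity observable `ζ₀` on the doubled modes. -/
def zeta0 (M : ℕ) [NeZero M] : Matrix (ZMod M ⊕ ZMod M) (ZMod M ⊕ ZMod M) ℂ :=
  Matrix.fromBlocks 1 0 0 (-1)

/-- The DQC1 transfer matrix `T(W,V)`. -/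
def Tdqc1 (M : ℕ) [NeZero M] (W V : Matrix (ZMod M) (ZMod M) ℂ) :
    Matrix (ZMod M ⊕ ZMod M) (ZMod M ⊕ ZMod M) ℂ :=
  Matrix.fromBlocks Wᴴ 0 0 1 * Hb M * Matrix.fromBlocks 1 0 0 V * Hb M *
    Matrix.fromBlocks W 0 0 1

theorem Tdqc1_eq_fromBlocks (M : ℕ) [NeZero M] (W V : Matrix (ZMod M) (ZMod M) ℂ)
    (hW : Wᴴ * W = 1) :
    Tdqc1 M W V = ((1 : ℂ) / 2) •
      Matrix.fromBlocks (1 + Wᴴ * V * W) (Wᴴ * (1 - V)) ((1 - V) * W) (1 + V) := by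
  have hc : ((1 : ℂ) / Real.sqrt 2) * ((1 : ℂ) / Real.sqrt 2) = 1 / 2 := by
    rw [div_mul_div_comm, ← Complex.ofReal_mul, Real.mul_self_sqrt zero_le_two]
    norm_num
  simp only [Tdqc1, Hb, Matrix.mul_smul, Matrix.smul_mul, smul_smul, hc,
    Matrix.fromBlocks_multiply]
  congr 1
  simp [Matrix.add_mul, Matrix.mul_add, hW, sub_eq_add_neg]

theorem Tdqc1_conj_zeta0 (M : ℕ) [NeZero M] (W V : Matrix (ZMod M) (ZMod M) ℂ)
    (hW : Wᴴ * W = 1) :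
    (Tdqc1 M W V)ᴴ * zeta0 M * Tdqc1 M W V =
      ((1 : ℂ) / 2) • Matrix.fromBlocks (Wᴴ * V * W + (Wᴴ * V * W)ᴴ) (Wᴴ * (Vᴴ - V))
        ((V - Vᴴ) * W) (-(V + Vᴴ)) := by
  have hW' : W * Wᴴ = 1 := mul_eq_one_comm.mp hW
  have hl (X : Matrix (ZMod M) (ZMod M) ℂ) : W * (Wᴴ * X) = X := by
    rw [← Matrix.mul_assoc, hW', Matrix.one_mul]
  have hs : (star ((1 : ℂ) / 2)) * (1 / 2) = (1 / 2) * (1 / 2) := by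
    simp
  rw [Tdqc1_eq_fromBlocks M W V hW, zeta0, Matrix.conjTranspose_smul,
    Matrix.fromBlocks_conjTranspose, Matrix.smul_mul, Matrix.smul_mul, Matrix.mul_smul,
    smul_smul, hs, mul_smul]
  congr 1
  simp only [Matrix.fromBlocks_multiply, Matrix.fromBlocks_smul, Matrix.conjTranspose_add,
    Matrix.conjTranspose_sub, Matrix.conjTranspose_mul, Matrix.conjTranspose_one,
    Matrix.conjTranspose_conjTranspose, Matrix.mul_zero, Matrix.mul_one, Matrix.mul_neg,
    Matrix.neg_mul, add_zero, zero_add, Matrix.add_mul, Matrix.mul_add, Matrix.sub_mul,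
    Matrix.mul_sub, Matrix.one_mul, Matrix.mul_assoc, hl, hW, hW']
  congr 1 <;> module

/-- the DQC1 block identity
`T(W,V)ᴴ ζ₀ T(W,V) = (1/2) • fromBlocks (U+Uᴴ) (Wᴴ(Vᴴ−V)) ((V−Vᴴ)W) (−(V+Vᴴ))`,
whose upper-left block is `(U+Uᴴ)/2` for `U = Wᴴ V W`. -/
theorem DQC1_block_identity (M : ℕ) [NeZero M]
    (W V : Matrix (ZMod M) (ZMod M) ℂ) (hW : Wᴴ * W = 1) :
    let U := Wᴴ * V * W
    (Tdqc1 M W V)ᴴ * zeta0 M * Tdqc1 M W V =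
      ((1 : ℂ) / 2) • Matrix.fromBlocks (U + Uᴴ) (Wᴴ * (Vᴴ - V)) ((V - Vᴴ) * W)
        (-(V + Vᴴ)) ∧
    ((Tdqc1 M W V)ᴴ * zeta0 M * Tdqc1 M W V).toBlocks₁₁ =
      ((1 : ℂ) / 2) • (U + Uᴴ) := by
  intro U
  have h := Tdqc1_conj_zeta0 M W V hW
  refine ⟨h, ?_⟩
  rw [h, Matrix.fromBlocks_smul, Matrix.toBlocks_fromBlocks₁₁]

end
end

section
/- Let W, V : Matrix (ZMod M) (ZMod M) ℂ with W unitary (Wᴴ * W = 1), and let ρ : Matrix (ZMod M) (ZMod M) ℂ be Hermitian. Then the single-photon DQC1 expectation value recovers the real part of the expectation of U = Wᴴ * V * W: trace( (fromBlocks ρ 0 0 0) * (T(W,V)ᴴ * ζ₀ * T(W,V)) ) = Re(trace(ρ * Wᴴ * V * W)), where the right-hand side is regarded as a complex number. -/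
open Matrix Complex BigOperators Finset

noncomputable section

set_option linter.unusedVariables false

/-- The Mach–Zehnder interferometer with `V` in one arm. -/
theorem Hb_mul_fromBlocks_mul_Hb (M : ℕ) [NeZero M] (V : Matrix (ZMod M) (ZMod M) ℂ) :
    Hb M * fromBlocks 1 0 0 V * Hb M =
      (1 / 2 : ℂ) • fromBlocks (1 + V) (1 - V) (1 - V) (1 + V) := by
  have hs : (1 / (Real.sqrt 2 : ℂ)) * (1 / (Real.sqrt 2 : ℂ)) = 1 / 2 := by
    rw [div_mul_div_comm, ← Complex.ofReal_mul, Real.mul_self_sqrt zero_le_two]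
    norm_num
  simp only [Hb, Matrix.smul_mul, Matrix.mul_smul, smul_smul, hs, fromBlocks_multiply]
  simp [sub_eq_add_neg]

theorem Tdqc1_eq (M : ℕ) [NeZero M] (W V : Matrix (ZMod M) (ZMod M) ℂ) :
    Tdqc1 M W V =
      (1 / 2 : ℂ) • fromBlocks (Wᴴ * (1 + V) * W) (Wᴴ * (1 - V)) ((1 - V) * W) (1 + V) := by
  have h : Tdqc1 M W V = fromBlocks Wᴴ 0 0 1 * (Hb M * fromBlocks 1 0 0 V * Hb M) *
      fromBlocks W 0 0 1 := by
    simp only [Tdqc1, Matrix.mul_assoc]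
  rw [h, Hb_mul_fromBlocks_mul_Hb, Matrix.mul_smul, Matrix.smul_mul, fromBlocks_multiply,
    fromBlocks_multiply]
  simp

/-- The Heisenberg-evolved parity restricted to the first block of modes is the Hermitian part
of `Wᴴ * V * W`. -/
theorem toBlocks₁₁_conj_zeta0 (M : ℕ) [NeZero M] (W V : Matrix (ZMod M) (ZMod M) ℂ)
    (hW : Wᴴ * W = 1) :
    ((Tdqc1 M W V)ᴴ * zeta0 M * Tdqc1 M W V).toBlocks₁₁ =
      (1 / 2 : ℂ) • (Wᴴ * V * W + (Wᴴ * V * W)ᴴ) := by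
  have hW' : W * Wᴴ = 1 := mul_eq_one_comm.mp hW
  have h1 : (Wᴴ * (1 + V) * W)ᴴ * (Wᴴ * (1 + V) * W) = Wᴴ * ((1 + Vᴴ) * (1 + V)) * W := by
    calc (Wᴴ * (1 + V) * W)ᴴ * (Wᴴ * (1 + V) * W)
        = Wᴴ * (1 + Vᴴ) * (W * Wᴴ) * (1 + V) * W := by
          simp only [conjTranspose_mul, conjTranspose_add, conjTranspose_one,
            conjTranspose_conjTranspose, Matrix.mul_assoc]
      _ = _ := by rw [hW', Matrix.mul_one]; simp only [Matrix.mul_assoc]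
  have h2 : ((1 - V) * W)ᴴ * ((1 - V) * W) = Wᴴ * ((1 - Vᴴ) * (1 - V)) * W := by
    simp only [conjTranspose_mul, conjTranspose_sub, conjTranspose_one, Matrix.mul_assoc]
  have h3 : Wᴴ * ((1 + Vᴴ) * (1 + V)) * W - Wᴴ * ((1 - Vᴴ) * (1 - V)) * W =
      (2 : ℂ) • (Wᴴ * V * W + (Wᴴ * V * W)ᴴ) := by
    simp only [conjTranspose_mul, conjTranspose_conjTranspose, two_smul]
    noncomm_ring
  rw [Tdqc1_eq, zeta0, conjTranspose_smul, fromBlocks_conjTranspose, Matrix.smul_mul,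
    Matrix.smul_mul, Matrix.mul_smul,
    smul_smul, fromBlocks_multiply, fromBlocks_multiply, fromBlocks_smul, toBlocks_fromBlocks₁₁]
  simp only [Matrix.mul_one, Matrix.mul_zero, add_zero, zero_add, Matrix.mul_neg, Matrix.neg_mul,
    h1, h2]
  rw [← sub_eq_add_neg, h3, smul_smul]
  congr 1
  norm_num

theorem trace_fromBlocks_mul {n R : Type*} [Fintype n] [NonUnitalNonAssocSemiring R]
    (A : Matrix n n R) (B : Matrix (n ⊕ n) (n ⊕ n) R) :
    trace (fromBlocks A 0 0 0 * B) = trace (A * B.toBlocks₁₁) := by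
  conv_lhs => rw [← fromBlocks_toBlocks B, fromBlocks_multiply]
  simp [trace, Fintype.sum_sum_type]

theorem Matrix.IsHermitian.trace_mul_conjTranspose {n R : Type*} [Fintype n] [CommSemiring R]
    [StarRing R] {A : Matrix n n R} (hA : A.IsHermitian) (B : Matrix n n R) :
    trace (A * Bᴴ) = star (trace (A * B)) := by
  rw [← trace_conjTranspose, conjTranspose_mul, hA.eq, trace_mul_comm]

/-- the single-photon DQC1 expectation value recovers the real part of the
expectation of `U = Wᴴ V W`. -/
theorem DQC1_single_photon_real_part (M : ℕ) [NeZero M]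
    (W V : Matrix (ZMod M) (ZMod M) ℂ) (hW : Wᴴ * W = 1)
    (ρ : Matrix (ZMod M) (ZMod M) ℂ) (hρ : ρ.IsHermitian) :
    Matrix.trace (Matrix.fromBlocks ρ 0 0 0 *
        ((Tdqc1 M W V)ᴴ * zeta0 M * Tdqc1 M W V)) =
      ((Matrix.trace (ρ * (Wᴴ * V * W))).re : ℂ) := by
  rw [trace_fromBlocks_mul, toBlocks₁₁_conj_zeta0 M W V hW, Matrix.mul_smul, Matrix.mul_add,
    trace_smul,
    trace_add, hρ.trace_mul_conjTranspose, Complex.re_eq_add_conj, smul_eq_mul, starRingEnd_apply]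
  ring

end
end

section
/- (Erasing channel in multiphoton LONs.) Let V : Matrix S S ℂ, let k be a natural number, and let ν, n ∈ S. Let Zd = Λ_{0,1} (the diagonal matrix with entry ω^{μ(n)} at n). Then (1/M) · Σ_{m=0}^{M−1} ω^{m·k·N} · ((Zdᴴ)^m * V * Zd^m)[ν,n] equals V[ν,n] if μ(n) − μ(ν) = −(k·N : ZMod M) and equals 0 otherwise; likewise (1/M) · Σ_{m=0}^{M−1} ω^{−m·k·N} · ((Zdᴴ)^m * V * Zd^m)[ν,n] equals V[ν,n] if μ(n) − μ(ν) = (k·N : ZMod M) and equals 0 otherwise (here ω^{±m·k·N} means exp(±2πi·m·k·N/M)). -/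
open Matrix Complex BigOperators Finset

noncomputable section

set_option linter.unusedVariables false

lemma isPrimitiveRoot_hwOmega (M : ℕ) [NeZero M] : IsPrimitiveRoot (hwOmega M) M :=
  Complex.isPrimitiveRoot_exp M (NeZero.ne M)

lemma star_hwOmega (M : ℕ) [NeZero M] : star (hwOmega M) = (hwOmega M)⁻¹ :=
  (Complex.inv_eq_conj ((isPrimitiveRoot_hwOmega M).norm'_eq_one (NeZero.ne M))).symm

/-- Orthogonality of the characters of `ZMod M`. -/
lemma average_hwOmega_zpow_pow (M : ℕ) [NeZero M] (j : ℤ) :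
    (1 / (M : ℂ)) * ∑ m ∈ Finset.range M, (hwOmega M ^ j) ^ m =
      if (j : ZMod M) = 0 then 1 else 0 := by
  have hω := isPrimitiveRoot_hwOmega M
  have hj : hwOmega M ^ j = 1 ↔ (j : ZMod M) = 0 := by
    rw [hω.zpow_eq_one_iff_dvd, ZMod.intCast_zmod_eq_zero_iff_dvd]
  split_ifs with h <;> rw [← hj] at h
  · simp [h, NeZero.ne M]
  · rw [geom_sum_eq h, ← _root_.zpow_natCast, ← _root_.zpow_mul, mul_comm j, _root_.zpow_mul,
      _root_.zpow_natCast, hω.pow_eq_one]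
    simp

lemma HWm_zero_one (M N : ℕ) [NeZero M] :
    HWm M N 0 1 = Matrix.diagonal fun n => hwOmega M ^ (tmi M N n).val := by
  ext v n
  by_cases h : v = n
  · subst h
    simp [HWm]
  · simp [HWm, h]

lemma conj_HWm_zero_one_pow_apply (M N : ℕ) [NeZero M]
    (V : Matrix (Fock M N) (Fock M N) ℂ) (m : ℕ) (ν n : Fock M N) :
    (((HWm M N 0 1)ᴴ) ^ m * V * (HWm M N 0 1) ^ m) ν n =
      (hwOmega M ^ (((tmi M N n).val : ℤ) - (tmi M N ν).val)) ^ m * V ν n := by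
  have h0 : hwOmega M ≠ 0 := (isPrimitiveRoot_hwOmega M).ne_zero (NeZero.ne M)
  rw [HWm_zero_one, Matrix.diagonal_conjTranspose, Matrix.diagonal_pow, Matrix.diagonal_pow,
    Matrix.mul_diagonal, Matrix.diagonal_mul]
  simp only [Pi.pow_apply, Pi.star_apply, star_pow, star_hwOmega]
  rw [zpow_sub₀ h0, zpow_natCast, zpow_natCast, div_eq_mul_inv, mul_pow, inv_pow]
  ring

lemma average_conj_HWm_zero_one (M N : ℕ) [NeZero M]
    (V : Matrix (Fock M N) (Fock M N) ℂ) (j : ℤ) (ν n : Fock M N) :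
    (1 / (M : ℂ)) * ∑ m ∈ Finset.range M, (hwOmega M ^ j) ^ m *
        ((((HWm M N 0 1)ᴴ) ^ m * V * (HWm M N 0 1) ^ m) ν n) =
      if tmi M N n - tmi M N ν = -(j : ZMod M) then V ν n else 0 := by
  have h0 : hwOmega M ≠ 0 := (isPrimitiveRoot_hwOmega M).ne_zero (NeZero.ne M)
  simp only [conj_HWm_zero_one_pow_apply, ← mul_assoc, ← mul_pow, ← zpow_add₀ h0]
  rw [← Finset.sum_mul, ← mul_assoc, average_hwOmega_zpow_pow, ite_mul, one_mul, zero_mul]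
  refine if_congr ?_ rfl rfl
  push_cast
  rw [ZMod.natCast_zmod_val, ZMod.natCast_zmod_val, eq_neg_iff_add_eq_zero, add_comm]

/-- erasing channel in multiphoton LONs: with `Zd = Λ_{0,1}`, averaging the
conjugates `(Zdᴴ)^m V Zd^m` against `ω^{±mkN}` selects the entries with
`μ(n) − μ(ν) = ∓ kN`. -/
theorem erasing_channel (M N : ℕ) [NeZero M] (hN : 1 ≤ N)
    (V : Matrix (Fock M N) (Fock M N) ℂ) (k : ℕ) (ν n : Fock M N) :
    ((1 / (M : ℂ)) * ∑ m ∈ Finset.range M, hwOmega M ^ (m * k * N) *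
        ((((HWm M N 0 1)ᴴ) ^ m * V * (HWm M N 0 1) ^ m) ν n) =
      if tmi M N n - tmi M N ν = -((k * N : ℕ) : ZMod M) then V ν n else 0) ∧
    ((1 / (M : ℂ)) * ∑ m ∈ Finset.range M, (hwOmega M)⁻¹ ^ (m * k * N) *
        ((((HWm M N 0 1)ᴴ) ^ m * V * (HWm M N 0 1) ^ m) ν n) =
      if tmi M N n - tmi M N ν = ((k * N : ℕ) : ZMod M) then V ν n else 0) := by
  constructor
  · simpa only [_root_.zpow_natCast, ← pow_mul', ← mul_assoc, Int.cast_natCast] using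
      average_conj_HWm_zero_one M N V ((k * N : ℕ) : ℤ) ν n
  · simpa only [_root_.zpow_neg, _root_.zpow_natCast, ← inv_pow, ← pow_mul', ← mul_assoc,
      Int.cast_neg, Int.cast_natCast, neg_neg] using
      average_conj_HWm_zero_one M N V (-((k * N : ℕ) : ℤ)) ν n

end
end

section
/- (DQC1 evaluation of Heisenberg–Weyl operators with two detectors.) Let k, l be natural numbers with 1 ≤ k, assume N · gcd(2k, M) ≤ M, let θ ∈ ℝ, let W : Matrix (ZMod M) (ZMod M) ℂ be unitary, and let ρ : Matrix S S ℂ be Hermitian. Set δ = 1 if M divides 2·k·N and δ = 0 otherwise, and for m ∈ {0,…,M−1} set V_m = exp(i·(θ + 2π·k·m/M)) • L_{k,l}. Then Re( exp(i·θ·N) · trace(ρ * Γ-matrix of (Wᴴ * L_{k,l} * W)) ) = (2^{N−δ}/M) · Σ_{m=0}^{M−1} cos(2π·k·m·N/M) · trace( ι(ρ) * Γ₂-matrix of (T(W,V_m)ᴴ * ζ₀ * T(W,V_m)) ), where the Γ-matrix of a mode matrix A is the S×S matrix with entries Γ(A)[ν,n], and similarly for Γ₂ on S₂. -/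
open Matrix Complex BigOperators Finset

noncomputable section

set_option linter.unusedVariables false

/-- `f : Fin N → ZMod M` enumerates the Fock vector `n`: each fiber `f⁻¹{m}` has `n(m)` elements. -/
def IsEnum (M N : ℕ) [NeZero M] (n : Fock M N) (f : Fin N → ZMod M) : Prop :=
  ∀ m : ZMod M, (Finset.univ.filter fun i => f i = m).card = n.1 m

/-- Fock vectors on the doubled modes `ZMod M ⊕ ZMod M` with total photon number `N`. -/
abbrev Fock2 (M N : ℕ) [NeZero M] := {n : ZMod M ⊕ ZMod M → ℕ // ∑ m, n m = N}

instance (M N : ℕ) [NeZero M] : Fintype (Fock2 M N) :=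
  Fintype.ofInjective
    (fun n (m : ZMod M ⊕ ZMod M) => (⟨n.1 m, Nat.lt_succ_of_le (le_of_le_of_eq
      (Finset.single_le_sum (fun i _ => Nat.zero_le _) (Finset.mem_univ m)) n.2)⟩ : Fin (N+1)))
    (fun a b h => Subtype.ext (funext fun m => congrArg Fin.val (congrFun h m)))

/-- The embedding `ν ↦ ν⊕0` of single-wing Fock vectors into doubled-mode Fock vectors. -/
def femb (M N : ℕ) [NeZero M] (ν : Fock M N) : Fock2 M N :=
  ⟨Sum.elim ν.1 (fun _ => 0), by
    rw [Fintype.sum_sum_type]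
    simpa using ν.2⟩

/-- The embedding `ι` of an `S × S` matrix as an `S₂ × S₂` matrix supported on `ν⊕0` indices. -/
def iota (M N : ℕ) [NeZero M] (ρ : Matrix (Fock M N) (Fock M N) ℂ) :
    Matrix (Fock2 M N) (Fock2 M N) ℂ :=
  Matrix.of fun a b => ∑ ν : Fock M N, ∑ n : Fock M N,
    if a = femb M N ν ∧ b = femb M N n then ρ ν n else 0

/-- `f : Fin N → ZMod M ⊕ ZMod M` enumerates the doubled-mode Fock vector `n`. -/
def IsEnum2 (M N : ℕ) [NeZero M] (n : Fock2 M N) (f : Fin N → ZMod M ⊕ ZMod M) : Prop :=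
  ∀ m : ZMod M ⊕ ZMod M, (Finset.univ.filter fun i => f i = m).card = n.1 m

/-- Orthogonality of the characters `m ↦ exp(2πi·a·m/M)` on `ZMod M`. -/
theorem sum_exp_two_pi_mul_div (M : ℕ) [NeZero M] (a : ℤ) :
    ∑ m ∈ Finset.range M, Complex.exp (2 * Real.pi * Complex.I * a / M * m) =
      if (M : ℤ) ∣ a then (M : ℂ) else 0 := by
  have hM : (M : ℂ) ≠ 0 := Nat.cast_ne_zero.mpr (NeZero.ne M)
  have hpow : ∀ m : ℕ, Complex.exp (2 * Real.pi * Complex.I * a / M * m) =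
      Complex.exp (2 * Real.pi * Complex.I * a / M) ^ m := fun m => by
    rw [← Complex.exp_nat_mul, mul_comm]
  simp_rw [hpow]
  split_ifs with h
  · obtain ⟨c, rfl⟩ := h
    have h1 : Complex.exp (2 * Real.pi * Complex.I * ((M * c : ℤ) : ℂ) / M) = 1 := by
      rw [Complex.exp_eq_one_iff]
      refine ⟨c, ?_⟩
      push_cast
      field_simp
    simp only [h1, one_pow, Finset.sum_const, Finset.card_range, nsmul_one]
  · have h1 : Complex.exp (2 * Real.pi * Complex.I * a / M) ≠ 1 := by
      rw [Ne, Complex.exp_eq_one_iff]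
      rintro ⟨c, hc⟩
      apply h
      refine ⟨c, ?_⟩
      have h2 : (2 * Real.pi * Complex.I : ℂ) ≠ 0 := Complex.two_pi_I_ne_zero
      field_simp at hc
      have h3 : (a : ℂ) = M * c := hc
      exact_mod_cast h3
    have h2 := mul_geom_sum (Complex.exp (2 * Real.pi * Complex.I * a / M)) M
    have h3 : Complex.exp (2 * Real.pi * Complex.I * a / M) ^ M = 1 := by
      rw [← Complex.exp_nat_mul, Complex.exp_eq_one_iff]
      refine ⟨a, ?_⟩
      field_simp
    rw [h3, sub_self] at h2
    exact (mul_eq_zero.mp h2).resolve_left (sub_ne_zero.mpr h1)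

/-- If `N * gcd(a, M) ≤ M`, then the only multiples `a * j` with `j ≤ N` divisible by `M` occur
at `j = 0` and possibly `j = N`. -/
theorem eq_zero_or_eq_of_dvd_mul {M N a j : ℕ} (hM : 0 < M) (h : N * Nat.gcd a M ≤ M)
    (hj : j ≤ N) (hd : M ∣ a * j) : j = 0 ∨ j = N := by
  rcases Nat.eq_zero_or_pos j with h0 | h0
  · exact Or.inl h0
  right
  have hg : 0 < Nat.gcd a M := Nat.gcd_pos_of_pos_right a hM
  have h1 : M ∣ Nat.gcd a M * j := by
    rw [← Nat.gcd_mul_right]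
    exact Nat.dvd_gcd hd (Dvd.intro j rfl)
  have h2 := Nat.le_of_dvd (Nat.mul_pos hg h0) h1
  have h3 : N * Nat.gcd a M ≤ j * Nat.gcd a M := by linarith [mul_comm j (Nat.gcd a M)]
  exact le_antisymm hj (Nat.le_of_mul_le_mul_right h3 hg)

/-- The cosine average isolates the two extreme Fourier components. -/
theorem cos_average_phase (M : ℕ) [NeZero M] (k j p : ℕ) (hN : 1 ≤ j + p)
    (hkM : (j + p) * Nat.gcd (2 * k) M ≤ M) (θ : ℝ) :
    ((2 : ℂ) ^ (j + p - (if M ∣ 2 * k * (j + p) then 1 else 0)) / (M : ℂ)) *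
        ∑ m ∈ Finset.range M,
          ((Real.cos (2 * Real.pi * k * m * (j + p : ℕ) / M) : ℝ) : ℂ) *
          ((Complex.exp (Complex.I * ((θ : ℂ) + 2 * Real.pi * k * m / M)) / 2) ^ j *
            (Complex.exp (-(Complex.I * ((θ : ℂ) + 2 * Real.pi * k * m / M))) / 2) ^ p) =
      (1 / 2) * ((if p = 0 then Complex.exp (Complex.I * θ * (j + p : ℕ)) else 0) +
        (if j = 0 then Complex.exp (-(Complex.I * θ * (j + p : ℕ))) else 0)) := by
  have hM0 : 0 < M := Nat.pos_of_ne_zero (NeZero.ne M)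
  have hM : (M : ℂ) ≠ 0 := Nat.cast_ne_zero.mpr (NeZero.ne M)
  have hterm : ∀ m : ℕ, ((Real.cos (2 * Real.pi * k * m * (j + p : ℕ) / M) : ℝ) : ℂ) *
          ((Complex.exp (Complex.I * ((θ : ℂ) + 2 * Real.pi * k * m / M)) / 2) ^ j *
            (Complex.exp (-(Complex.I * ((θ : ℂ) + 2 * Real.pi * k * m / M))) / 2) ^ p) =
      (Complex.exp (Complex.I * θ * (j - p)) / 2 ^ (j + p) / 2) *
        (Complex.exp (2 * Real.pi * Complex.I * ((2 * k * j : ℕ) : ℤ) / M * m) +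
          Complex.exp (2 * Real.pi * Complex.I * (-((2 * k * p : ℕ) : ℤ) : ℤ) / M * m)) := by
    intro m
    rw [Complex.ofReal_cos, Complex.cos, div_pow, div_pow, ← Complex.exp_nat_mul,
      ← Complex.exp_nat_mul, pow_add]
    have e1 : Complex.exp (Complex.I * θ * (j - p)) *
        Complex.exp (2 * Real.pi * Complex.I * ((2 * k * j : ℕ) : ℤ) / M * m) =
        Complex.exp (((2 * Real.pi * k * m * (j + p : ℕ) / M : ℝ) : ℂ) * Complex.I) *
        (Complex.exp (j * (Complex.I * ((θ : ℂ) + 2 * Real.pi * k * m / M))) *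
        Complex.exp (p * (-(Complex.I * ((θ : ℂ) + 2 * Real.pi * k * m / M))))) := by
      simp only [← Complex.exp_add]
      congr 1
      push_cast
      ring
    have e2 : Complex.exp (Complex.I * θ * (j - p)) *
        Complex.exp (2 * Real.pi * Complex.I * (-((2 * k * p : ℕ) : ℤ) : ℤ) / M * m) =
        Complex.exp (-((2 * Real.pi * k * m * (j + p : ℕ) / M : ℝ) : ℂ) * Complex.I) *
        (Complex.exp (j * (Complex.I * ((θ : ℂ) + 2 * Real.pi * k * m / M))) *
        Complex.exp (p * (-(Complex.I * ((θ : ℂ) + 2 * Real.pi * k * m / M))))) := by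
      simp only [← Complex.exp_add]
      congr 1
      push_cast
      ring
    linear_combination (-(1 / (2 ^ j * 2 ^ p * 2) : ℂ)) * e1 - (1 / (2 ^ j * 2 ^ p * 2) : ℂ) * e2
  rw [Finset.sum_congr rfl fun m _ => hterm m, ← Finset.mul_sum, Finset.sum_add_distrib,
    sum_exp_two_pi_mul_div, sum_exp_two_pi_mul_div]
  simp only [dvd_neg, Int.natCast_dvd_natCast]
  have hj := eq_zero_or_eq_of_dvd_mul (j := j) hM0 hkM (by omega)
  have hp := eq_zero_or_eq_of_dvd_mul (j := p) hM0 hkM (by omega)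
  have h2 : (2 : ℂ) ^ (j + p) = 2 ^ (j + p - 1) * 2 := by
    rw [← pow_succ]; congr 1; omega
  rcases Nat.eq_zero_or_pos j with rfl | hj0
  · have hp0 : p ≠ 0 := by omega
    simp only [zero_add] at h2 ⊢
    by_cases hd : M ∣ 2 * k * p
    · simp [hd, hp0]
      rw [h2]
      field_simp
      ring
    · simp [hd, hp0]
      field_simp
  · rcases Nat.eq_zero_or_pos p with rfl | hp0
    · simp only [add_zero] at h2 ⊢
      by_cases hd : M ∣ 2 * k * j
      · simp [hd, hj0.ne']
        rw [h2]
        field_simp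
        ring
      · simp [hd, hj0.ne']
        field_simp
    · have h3 : ¬ M ∣ 2 * k * j := fun h => by have := hj h; omega
      have h4 : ¬ M ∣ 2 * k * p := fun h => by have := hp h; omega
      simp [h3, h4, hj0.ne', hp0.ne']

/-- Expansion of the permanent of `x • A + y • B` by the rows taken from `A`. -/
theorem permanent_smul_add_smul {N : ℕ} (A B : Matrix (Fin N) (Fin N) ℂ) (x y : ℂ) :
    (x • A + y • B).permanent = ∑ σ : Equiv.Perm (Fin N), ∑ s : Finset (Fin N),
      (x ^ s.card * y ^ (N - s.card)) *
        ((∏ i ∈ s, A (σ i) i) * ∏ i ∈ univ \ s, B (σ i) i) := by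
  unfold Matrix.permanent
  refine Finset.sum_congr rfl fun σ _ => ?_
  simp only [Matrix.add_apply, Matrix.smul_apply, smul_eq_mul]
  rw [Finset.prod_add]
  simp only [Finset.powerset_univ]
  refine Finset.sum_congr rfl fun s _ => ?_
  rw [Finset.prod_mul_distrib, Finset.prod_mul_distrib, Finset.prod_const, Finset.prod_const,
    Finset.card_sdiff_of_subset (Finset.subset_univ s), Finset.card_univ, Fintype.card_fin]
  ring

/-- The cosine average of `perm((e^{iφ} A + e^{-iφ} B)/2)` over the phases keeps only the pure
`A` and pure `B` contributions. -/
theorem cos_average_permanent (M N : ℕ) [NeZero M] (k : ℕ) (hN : 1 ≤ N)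
    (hkM : N * Nat.gcd (2 * k) M ≤ M) (θ : ℝ) (A B : Matrix (Fin N) (Fin N) ℂ) :
    ((2 : ℂ) ^ (N - (if M ∣ 2 * k * N then 1 else 0)) / (M : ℂ)) *
        ∑ m ∈ Finset.range M, ((Real.cos (2 * Real.pi * k * m * N / M) : ℝ) : ℂ) *
          ((Complex.exp (Complex.I * ((θ : ℂ) + 2 * Real.pi * k * m / M)) / 2) • A +
            (Complex.exp (-(Complex.I * ((θ : ℂ) + 2 * Real.pi * k * m / M))) / 2) •
              B).permanent =
      (1 / 2) * (Complex.exp (Complex.I * θ * N) * A.permanent +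
        Complex.exp (-(Complex.I * θ * N)) * B.permanent) := by
  have key : ∀ j ≤ N, ((2 : ℂ) ^ (N - (if M ∣ 2 * k * N then 1 else 0)) / (M : ℂ)) *
        ∑ m ∈ Finset.range M, ((Real.cos (2 * Real.pi * k * m * N / M) : ℝ) : ℂ) *
          ((Complex.exp (Complex.I * ((θ : ℂ) + 2 * Real.pi * k * m / M)) / 2) ^ j *
            (Complex.exp (-(Complex.I * ((θ : ℂ) + 2 * Real.pi * k * m / M))) / 2) ^ (N - j)) =
      (1 / 2) * ((if N - j = 0 then Complex.exp (Complex.I * θ * N) else 0) +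
        (if j = 0 then Complex.exp (-(Complex.I * θ * N)) else 0)) := by
    intro j hj
    obtain ⟨p, rfl⟩ := Nat.exists_eq_add_of_le hj
    rw [Nat.add_sub_cancel_left]
    exact cos_average_phase M k j p hN hkM θ
  have hcard : ∀ s : Finset (Fin N), s.card ≤ N := fun s => by
    simpa using Finset.card_le_univ s
  simp_rw [permanent_smul_add_smul, Finset.mul_sum]
  rw [Finset.sum_comm]
  unfold Matrix.permanent
  rw [Finset.mul_sum, Finset.mul_sum, ← Finset.sum_add_distrib, Finset.mul_sum]
  refine Finset.sum_congr rfl fun σ _ => ?_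
  rw [Finset.sum_comm]
  have hs : ∀ s : Finset (Fin N), N - s.card = 0 ↔ s = univ := fun s => by
    rw [← Finset.card_eq_iff_eq_univ, Fintype.card_fin]
    have := hcard s
    omega
  calc _ = ∑ s : Finset (Fin N), ((1 / 2) *
        ((if s = univ then Complex.exp (Complex.I * θ * N) else 0) +
        (if s = ∅ then Complex.exp (-(Complex.I * θ * N)) else 0))) *
        ((∏ i ∈ s, A (σ i) i) * ∏ i ∈ univ \ s, B (σ i) i) := by
        refine Finset.sum_congr rfl fun s _ => ?_
        have h := key s.card (hcard s)
        simp only [hs, Finset.card_eq_zero] at h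
        rw [← h, Finset.mul_sum, Finset.sum_mul]
        refine Finset.sum_congr rfl fun m _ => ?_
        ring
    _ = _ := by
        simp only [mul_add, add_mul, Finset.sum_add_distrib, mul_ite, ite_mul, mul_zero,
          zero_mul, Finset.sum_ite_eq', Finset.mem_univ, if_true]
        simp
        ring

/-- The upper-left block of the conjugated parity observable is the Hermitian part of
`Wᴴ * V * W`. -/
theorem Tdqc1_conj_zeta0_inl_inl (M : ℕ) [NeZero M] (W V : Matrix (ZMod M) (ZMod M) ℂ)
    (hW : Wᴴ * W = 1) (a b : ZMod M) :
    ((Tdqc1 M W V)ᴴ * zeta0 M * Tdqc1 M W V) (Sum.inl a) (Sum.inl b) =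
      (1 / 2) * ((Wᴴ * V * W) a b + (Wᴴ * V * W)ᴴ a b) := by
  have hW' : W * Wᴴ = 1 := mul_eq_one_comm.mp hW
  have hT : Tdqc1 M W V = ((1 : ℂ) / 2) • Matrix.fromBlocks (Wᴴ * (1 + V) * W) (Wᴴ * (1 - V))
      ((1 - V) * W) (1 + V) := by
    have h2 : ((1 : ℂ) / Real.sqrt 2) * ((1 : ℂ) / Real.sqrt 2) = 1 / 2 := by
      rw [div_mul_div_comm, ← Complex.ofReal_mul, Real.mul_self_sqrt (by norm_num)]
      norm_num
    simp only [Tdqc1, Hb, Matrix.mul_smul, Matrix.smul_mul, smul_smul, h2,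
      Matrix.fromBlocks_multiply]
    congr 1
    simp [mul_add, add_mul, sub_eq_add_neg]
  have hblock : (Tdqc1 M W V)ᴴ * zeta0 M * Tdqc1 M W V = Matrix.fromBlocks
      (((1 : ℂ) / 2) • (Wᴴ * V * W + (Wᴴ * V * W)ᴴ))
      ((Tdqc1 M W V)ᴴ * zeta0 M * Tdqc1 M W V).toBlocks₁₂
      ((Tdqc1 M W V)ᴴ * zeta0 M * Tdqc1 M W V).toBlocks₂₁
      ((Tdqc1 M W V)ᴴ * zeta0 M * Tdqc1 M W V).toBlocks₂₂ := by
    conv_lhs => rw [← Matrix.fromBlocks_toBlocks ((Tdqc1 M W V)ᴴ * zeta0 M * Tdqc1 M W V)]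
    congr 1
    rw [hT, zeta0]
    simp only [Matrix.conjTranspose_smul, Matrix.fromBlocks_conjTranspose, Matrix.smul_mul,
      Matrix.mul_smul, Matrix.fromBlocks_multiply, Matrix.fromBlocks_smul,
      Matrix.toBlocks_fromBlocks₁₁, Matrix.conjTranspose_mul,
      Matrix.conjTranspose_add, Matrix.conjTranspose_sub, Matrix.conjTranspose_one,
      Matrix.conjTranspose_conjTranspose]
    have h1 : Wᴴ * ((1 + Vᴴ) * W) * (Wᴴ * (1 + V) * W) = Wᴴ * (1 + Vᴴ) * (1 + V) * W := by
      calc _ = Wᴴ * (1 + Vᴴ) * (W * Wᴴ) * (1 + V) * W := by simp only [Matrix.mul_assoc]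
        _ = _ := by rw [hW', Matrix.mul_one]
    have h3 : (star ((1 : ℂ) / 2) * (1 / 2)) = 1 / 4 := by
      simp
      norm_num
    simp only [Matrix.mul_one, Matrix.mul_zero, smul_zero, add_zero, zero_add, Matrix.mul_neg,
      Matrix.neg_mul, Matrix.smul_mul, smul_smul, mul_comm _ (star _), h3, h1,
      ← smul_add]
    rw [show (Wᴴ * (1 + Vᴴ) * (1 + V) * W + -(Wᴴ * (1 - Vᴴ) * ((1 - V) * W))) =
      (2 : ℂ) • (Wᴴ * V * W + Wᴴ * (Vᴴ * W)) by
        simp only [two_smul]; noncomm_ring]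
    rw [smul_smul]
    norm_num
  rw [hblock]
  simp only [Matrix.fromBlocks_apply₁₁, Matrix.smul_apply, Matrix.add_apply, smul_eq_mul]

/-- Every Fock vector has an enumeration of its photons. -/
theorem exists_isEnum (M N : ℕ) [NeZero M] (n : Fock M N) : ∃ f, IsEnum M N n f := by
  have hc : Fintype.card (Σ m : ZMod M, Fin (n.1 m)) = N := by simp [n.2]
  let e := Fintype.equivFinOfCardEq hc
  refine ⟨fun i => (e.symm i).1, fun m => ?_⟩
  rw [← Fintype.card_subtype,
    Fintype.card_congr (e.symm.subtypeEquiv (p := fun i => (e.symm i).1 = m)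
      (q := fun x => x.1 = m) fun _ => Iff.rfl),
    Fintype.card_congr (Equiv.sigmaSubtype m)]
  simp

theorem IsEnum.inl_comp {M N : ℕ} [NeZero M] {n : Fock M N} {f : Fin N → ZMod M}
    (hf : IsEnum M N n f) : IsEnum2 M N (femb M N n) (fun i => Sum.inl (f i)) := by
  rintro (m | m)
  · simpa [femb] using hf m
  · simp [femb]

theorem femb_injective (M N : ℕ) [NeZero M] : Function.Injective (femb M N) := fun a b h =>
  Subtype.ext (funext fun m => congrFun (congrArg Subtype.val h) (Sum.inl m))

theorem trace_iota_mul (M N : ℕ) [NeZero M] (ρ : Matrix (Fock M N) (Fock M N) ℂ)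
    (X : Matrix (Fock2 M N) (Fock2 M N) ℂ) :
    Matrix.trace (iota M N ρ * X) = ∑ ν, ∑ n, ρ ν n * X (femb M N n) (femb M N ν) := by
  simp only [Matrix.trace, Matrix.diag, Matrix.mul_apply, iota, Matrix.of_apply, Finset.sum_mul,
    ite_mul, zero_mul, ite_and]
  rw [Finset.sum_congr rfl fun _ _ => Finset.sum_comm, Finset.sum_comm]
  refine Finset.sum_congr rfl fun ν _ => ?_
  rw [Finset.sum_congr rfl fun _ _ => Finset.sum_comm, Finset.sum_comm]
  refine Finset.sum_congr rfl fun n _ => ?_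
  simp

theorem permanent_conjTranspose {N : ℕ} (A : Matrix (Fin N) (Fin N) ℂ) :
    Aᴴ.permanent = star A.permanent := by
  rw [← Matrix.permanent_transpose]
  simp [Matrix.permanent, star_sum, Matrix.conjTranspose_apply]

/-- DQC1 evaluation of Heisenberg–Weyl operators with two detectors:
`Re(e^{iθN} tr(ρ Γ(Wᴴ L_{k,l} W))) = (2^{N−δ}/M) Σ_m cos(2πkmN/M)
tr(ι(ρ) Γ₂(T(W,V_m)ᴴ ζ₀ T(W,V_m)))` with `V_m = e^{i(θ + 2πkm/M)} • L_{k,l}` and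
`δ = 𝟙[M ∣ 2kN]`. -/
theorem DQC1_HW_evaluation (M N : ℕ) [NeZero M] (hN : 1 ≤ N) (k l : ℕ) (hk : 1 ≤ k)
    (hkM : N * Nat.gcd (2 * k) M ≤ M) (θ : ℝ)
    (W : Matrix (ZMod M) (ZMod M) ℂ) (hW : Wᴴ * W = 1)
    (ρ : Matrix (Fock M N) (Fock M N) ℂ) (hρ : ρ.IsHermitian)
    (G : Matrix (Fock M N) (Fock M N) ℂ)
    (hG : ∀ (ν n : Fock M N) (f g : Fin N → ZMod M),
      IsEnum M N ν f → IsEnum M N n g →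
      G ν n = Matrix.permanent (Matrix.of fun i j : Fin N =>
          (Wᴴ * HW M (k : ZMod M) (l : ZMod M) * W) (f i) (g j)) /
        (Real.sqrt (((∏ m, Nat.factorial (ν.1 m)) * ∏ m, Nat.factorial (n.1 m) : ℕ)) : ℂ))
    (G₂ : ℕ → Matrix (Fock2 M N) (Fock2 M N) ℂ)
    (hG₂ : ∀ (m : ℕ) (a b : Fock2 M N) (f g : Fin N → ZMod M ⊕ ZMod M),
      IsEnum2 M N a f → IsEnum2 M N b g →
      G₂ m a b = Matrix.permanent (Matrix.of fun i j : Fin N =>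
          ((Tdqc1 M W (Complex.exp (Complex.I * ((θ : ℂ) + 2 * Real.pi * k * m / M)) •
              HW M (k : ZMod M) (l : ZMod M)))ᴴ * zeta0 M *
            Tdqc1 M W (Complex.exp (Complex.I * ((θ : ℂ) + 2 * Real.pi * k * m / M)) •
              HW M (k : ZMod M) (l : ZMod M))) (f i) (g j)) /
        (Real.sqrt (((∏ m, Nat.factorial (a.1 m)) * ∏ m, Nat.factorial (b.1 m) : ℕ)) : ℂ)) :
    ((Complex.exp (Complex.I * (θ : ℂ) * (N : ℂ)) * Matrix.trace (ρ * G)).re : ℂ) =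
      ((2 : ℂ) ^ (N - (if M ∣ 2 * k * N then 1 else 0)) / (M : ℂ)) *
        ∑ m ∈ Finset.range M, ((Real.cos (2 * Real.pi * k * m * N / M) : ℝ) : ℂ) *
          Matrix.trace (iota M N ρ * G₂ m) := by
  set L := Wᴴ * HW M (k : ZMod M) (l : ZMod M) * W with hL
  have hentry : ∀ ν n : Fock M N,
      ((2 : ℂ) ^ (N - (if M ∣ 2 * k * N then 1 else 0)) / (M : ℂ)) *
        ∑ m ∈ Finset.range M, ((Real.cos (2 * Real.pi * k * m * N / M) : ℝ) : ℂ) *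
          G₂ m (femb M N ν) (femb M N n) =
      (1 / 2) * (Complex.exp (Complex.I * θ * N) * G ν n +
        star (Complex.exp (Complex.I * θ * N) * G n ν)) := by
    intro ν n
    obtain ⟨f, hf⟩ := exists_isEnum M N ν
    obtain ⟨g, hg⟩ := exists_isEnum M N n
    have hT : ∀ m : ℕ, (Matrix.of fun i j : Fin N =>
          ((Tdqc1 M W (Complex.exp (Complex.I * ((θ : ℂ) + 2 * Real.pi * k * m / M)) •
              HW M (k : ZMod M) (l : ZMod M)))ᴴ * zeta0 M *
            Tdqc1 M W (Complex.exp (Complex.I * ((θ : ℂ) + 2 * Real.pi * k * m / M)) •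
              HW M (k : ZMod M) (l : ZMod M))) (Sum.inl (f i)) (Sum.inl (g j))) =
        (Complex.exp (Complex.I * ((θ : ℂ) + 2 * Real.pi * k * m / M)) / 2) •
            (Matrix.of fun i j : Fin N => L (f i) (g j)) +
          (Complex.exp (-(Complex.I * ((θ : ℂ) + 2 * Real.pi * k * m / M))) / 2) •
            (Matrix.of fun i j : Fin N => L (g i) (f j))ᴴ := by
      intro m
      have hstar : star (Complex.exp (Complex.I * ((θ : ℂ) + 2 * Real.pi * k * m / M))) =
          Complex.exp (-(Complex.I * ((θ : ℂ) + 2 * Real.pi * k * m / M))) := by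
        rw [← starRingEnd_apply, ← Complex.exp_conj]
        simp [Complex.conj_ofNat]
      ext i j
      simp only [Matrix.of_apply, Tdqc1_conj_zeta0_inl_inl M W _ hW, Matrix.add_apply,
        Matrix.smul_apply, Matrix.mul_smul, Matrix.smul_mul, Matrix.conjTranspose_apply,
        smul_eq_mul, star_mul', hstar, ← hL]
      ring
    have hfac : ∀ ν : Fock M N, ∏ m, Nat.factorial ((femb M N ν).1 m) =
        ∏ m, Nat.factorial (ν.1 m) := fun ν => by
      simp [femb, Fintype.prod_sum_type]
    have hG₂' := fun m => hG₂ m _ _ _ _ hf.inl_comp hg.inl_comp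
    simp only [hT, hfac] at hG₂'
    simp only [hG₂', hG _ _ _ _ hf hg, hG _ _ _ _ hg hf]
    have h := cos_average_permanent M N k hN hkM θ (Matrix.of fun i j : Fin N => L (f i) (g j))
      (Matrix.of fun i j : Fin N => L (g i) (f j))ᴴ
    have hexp : star (Complex.exp (Complex.I * θ * N)) = Complex.exp (-(Complex.I * θ * N)) := by
      rw [← starRingEnd_apply, ← Complex.exp_conj]
      simp
    rw [permanent_conjTranspose] at h
    simp only [star_mul', star_div₀, hexp]
    rw [mul_comm (∏ m, Nat.factorial (n.1 m))]
    simp only [← mul_div_assoc]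
    rw [← Finset.sum_div, mul_div_assoc', h]
    simp only [← starRingEnd_apply, Complex.conj_ofReal]
    ring
  have htr : ((2 : ℂ) ^ (N - (if M ∣ 2 * k * N then 1 else 0)) / (M : ℂ)) *
        ∑ m ∈ Finset.range M, ((Real.cos (2 * Real.pi * k * m * N / M) : ℝ) : ℂ) *
          Matrix.trace (iota M N ρ * G₂ m) =
      ∑ ν, ∑ n, ρ ν n * ((1 / 2) * (Complex.exp (Complex.I * θ * N) * G n ν +
        star (Complex.exp (Complex.I * θ * N) * G ν n))) := by
    simp only [trace_iota_mul, ← hentry, Finset.mul_sum]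
    rw [Finset.sum_comm]
    refine Finset.sum_congr rfl fun ν _ => ?_
    rw [Finset.sum_comm]
    refine Finset.sum_congr rfl fun n _ => Finset.sum_congr rfl fun m _ => ?_
    ring
  rw [htr, Complex.re_eq_add_conj]
  have h1 : Matrix.trace (ρ * G) = ∑ ν, ∑ n, ρ ν n * G n ν := by
    simp [Matrix.trace, Matrix.mul_apply]
  have h2 : starRingEnd ℂ (Matrix.trace (ρ * G)) = ∑ ν, ∑ n, ρ ν n * star (G ν n) := by
    rw [h1, Finset.sum_comm, map_sum]
    refine Finset.sum_congr rfl fun ν _ => ?_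
    rw [map_sum]
    refine Finset.sum_congr rfl fun n _ => ?_
    rw [map_mul, starRingEnd_apply, starRingEnd_apply, hρ.apply]
  rw [map_mul, h2, h1]
  simp only [Finset.mul_sum, ← Finset.sum_add_distrib, Finset.sum_div]
  refine Finset.sum_congr rfl fun ν _ => Finset.sum_congr rfl fun n _ => ?_
  rw [star_mul', starRingEnd_apply]
  ring

end
end
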